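/- Let R₁ and R₂ be algebraic curvature tensors on real inner product spaces (V₁,g₁) and (V₂,g₂) of dimensions n₁ ≤ 3 and n₂ ≤ 3 respectively, and let R = R₁ ⊕ R₂ be the product curvature tensor on the orthogonal direct sum (V₁ ⊕ V₂, g₁ ⊕ g₂), i.e. the unique (2,2)-double form agreeing with R₁ (resp. R₂) on arguments all from V₁ (resp. all from V₂) and vanishing whenever its arguments mix the two factors. Then h₄(R) = (1/2)·Scal(R₁)·Scal(R₂). -/

import Mathlib

/-!
Double forms on an `n`-dimensional real inner product space `(V, g)`, represented
by their components with respect to a (fixed) orthonormal basis: a `(p,q)`-double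
form is determined by its values on pairs of increasingly ordered tuples of
distinct basis vectors, i.e. by a function `Finset (Fin n) → Finset (Fin n) → ℝ`
(supported on pairs of sets of cardinalities `p` and `q`).
-/

open Finset

noncomputable section

abbrev DF (n : ℕ) := Finset (Fin n) → Finset (Fin n) → ℝ

namespace DF

variable {n : ℕ}

/-- The sign of the shuffle placing the increasing enumeration of `A` before that of
`B` and reordering increasingly. -/
def shuffleSign (A B : Finset (Fin n)) : ℝ :=
  (-1 : ℝ) ^ ∑ a ∈ A, (B.filter fun b => b < a).card

/-- The exterior product of double forms (Kulkarni–Nomizu type product), in components. -/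
def mul (ω θ : DF n) : DF n := fun S T =>
  ∑ A ∈ S.powerset, ∑ C ∈ T.powerset,
    shuffleSign A (S \ A) * shuffleSign C (T \ C) * ω A C * θ (S \ A) (T \ C)

/-- The `(0,0)`-double form `1`. -/
def one (n : ℕ) : DF n := fun S T => if S = ∅ ∧ T = ∅ then 1 else 0

/-- Powers `ω^k` of a double form with respect to the exterior product. -/
def pow (ω : DF n) : ℕ → DF n
  | 0 => one n
  | k + 1 => mul (pow ω k) ω

/-- The contraction `c ω`, obtained by summing, over an orthonormal basis, the
insertion of the basis vector as first argument in both slots. -/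
def contr (ω : DF n) : DF n := fun S T =>
  ∑ i : Fin n,
    if i ∈ S ∨ i ∈ T then 0
    else shuffleSign {i} S * shuffleSign {i} T * ω (insert i S) (insert i T)

/-- The iterated contraction `c^r`. -/
def contrN (r : ℕ) (ω : DF n) : DF n := contr^[r] ω

/-- The metric `g` as a `(1,1)`-double form (components in an orthonormal basis). -/
def gm (n : ℕ) : DF n := fun S T => if S = T ∧ S.card = 1 then 1 else 0

/-- The inner product of double forms induced by `g`. -/
def dinner (ω θ : DF n) : ℝ :=
  ∑ S : Finset (Fin n), ∑ T : Finset (Fin n), ω S T * θ S T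

/-- The scalar given by a `(0,0)`-double form. -/
def toScalar (ω : DF n) : ℝ := ω ∅ ∅

open scoped Classical in
/-- `σ_k` of a `(1,1)`-double form: the `k`-th elementary symmetric function of the
eigenvalues of the corresponding self-adjoint endomorphism (whose matrix in the
orthonormal basis is the matrix of components). -/
def sigma (k : ℕ) (ω : DF n) : ℝ :=
  if h : (Matrix.of fun i j => ω {i} {j} : Matrix (Fin n) (Fin n) ℝ).IsHermitian then
    ∑ s ∈ Finset.powersetCard k (Finset.univ : Finset (Fin n)), ∏ i ∈ s, h.eigenvalues i
  else 0

/-- `ω` is a `(p,p)`-double form: its components are supported in bidegree `(p,p)`. -/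
def IsDeg (p : ℕ) (ω : DF n) : Prop := ∀ S T, ω S T ≠ 0 → S.card = p ∧ T.card = p

/-- Symmetry of a double form: `ω(a;b) = ω(b;a)`. -/
def IsSymm (ω : DF n) : Prop := ∀ S T, ω S T = ω T S

/-- The first Bianchi identity for a `(p,p)`-double form (in components): the complete
antisymmetrization over the first `p+1` vector arguments vanishes. -/
def FirstBianchi (p : ℕ) (ω : DF n) : Prop :=
  ∀ U T : Finset (Fin n), U.card = p + 1 → T.card = p - 1 →
    ∑ i ∈ U,
      (if i ∈ T then 0
       else shuffleSign {i} (U.erase i) * shuffleSign {i} T * ω (U.erase i) (insert i T)) = 0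

end DF

section Geometry

variable {n : ℕ} {V : Type*} [NormedAddCommGroup V] [InnerProductSpace ℝ V]

/-- The components, in the orthonormal basis `e`, of a `(p,p)`-double form given as a
function of `p + p` vector arguments. -/
def ofForm (e : OrthonormalBasis (Fin n) ℝ V) (p : ℕ)
    (ω : (Fin p → V) → (Fin p → V) → ℝ) : DF n := fun S T =>
  if h : S.card = p ∧ T.card = p then
    ω (fun i => e ((S.orderIsoOfFin h.1 i : Fin n)))
      (fun i => e ((T.orderIsoOfFin h.2 i : Fin n)))
  else 0

/-- The components of a bilinear form, viewed as a `(1,1)`-double form. -/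
def ofBilin (e : OrthonormalBasis (Fin n) ℝ V) (b : V → V → ℝ) : DF n :=
  ofForm e 1 fun x y => b (x 0) (y 0)

/-- The components of a `(2,2)`-double form given as a function of four vectors. -/
def ofCurv (e : OrthonormalBasis (Fin n) ℝ V) (R : V → V → V → V → ℝ) : DF n :=
  ofForm e 2 fun x y => R (x 0) (x 1) (y 0) (y 1)

/-- Bilinearity of a real-valued function of two vector arguments. -/
def IsBilin (b : V → V → ℝ) : Prop :=
  (∀ (c : ℝ) (x x' y : V), b (c • x + x') y = c * b x y + b x' y) ∧
  (∀ (c : ℝ) (x y y' : V), b x (c • y + y') = c * b x y + b x y')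

/-- Symmetry of a bilinear form. -/
def IsSymmBilin (b : V → V → ℝ) : Prop := ∀ x y, b x y = b y x

/-- An algebraic curvature tensor: a multilinear form of four vectors, antisymmetric
in the first two arguments, symmetric under exchange of the two pairs, and satisfying
the first Bianchi identity. -/
structure IsCurv (R : V → V → V → V → ℝ) : Prop where
  linear : ∀ (c : ℝ) (x x' y z w : V), R (c • x + x') y z w = c * R x y z w + R x' y z w
  antisymm : ∀ x y z w, R x y z w = - R y x z w
  pair_symm : ∀ x y z w, R x y z w = R z w x y
  bianchi : ∀ x y z w, R x y z w + R y z x w + R z x y w = 0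

/-- Multilinearity of a real-valued function of `p` vector arguments. -/
def IsMultilinear (p : ℕ) (f : (Fin p → V) → ℝ) : Prop :=
  ∀ (x : Fin p → V) (i : Fin p) (c : ℝ) (u v : V),
    f (Function.update x i (c • u + v)) =
      c * f (Function.update x i u) + f (Function.update x i v)

/-- A function of `p` vector arguments is alternating. -/
def IsAlt (p : ℕ) (f : (Fin p → V) → ℝ) : Prop :=
  ∀ (x : Fin p → V) (i j : Fin p), i ≠ j → x i = x j → f x = 0

/-- A `(p,p)`-double form, as a function of `p + p` vector arguments:
multilinear and alternating in each of the two blocks of arguments. -/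
def IsDoubleForm (p : ℕ) (ω : (Fin p → V) → (Fin p → V) → ℝ) : Prop :=
  (∀ y, IsMultilinear p fun x => ω x y) ∧ (∀ y, IsAlt p fun x => ω x y) ∧
  (∀ x, IsMultilinear p fun y => ω x y) ∧ (∀ x, IsAlt p fun y => ω x y)

/-- Symmetry of a `(p,p)`-double form: `ω(x;y) = ω(y;x)`. -/
def IsSymmForm (p : ℕ) (ω : (Fin p → V) → (Fin p → V) → ℝ) : Prop := ∀ x y, ω x y = ω y x

/-- The first Bianchi identity for a `(p,p)`-double form of vector arguments:
the complete antisymmetrization over the first `p+1` vector arguments vanishes. -/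
def FirstBianchiForm (p : ℕ) (hp : 0 < p) (ω : (Fin p → V) → (Fin p → V) → ℝ) : Prop :=
  ∀ (z : Fin (p + 1) → V) (y : Fin p → V),
    ∑ σ : Equiv.Perm (Fin (p + 1)),
      ((Equiv.Perm.sign σ : ℤ) : ℝ) *
        ω (fun i => z (σ (Fin.castSucc i))) (Function.update y ⟨0, hp⟩ (z (σ (Fin.last p)))) = 0

/-- The scalar curvature `Scal = c²R` of a `(2,2)`-double form (in components). -/
def scalDF {n : ℕ} (Rd : DF n) : ℝ := DF.toScalar (DF.contrN 2 Rd)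

/-- The `2k`-th Gauss–Bonnet curvature `h_{2k} = c^{2k} R^k / (2k)!`. -/
def h2kDF {n : ℕ} (k : ℕ) (Rd : DF n) : ℝ :=
  DF.toScalar (DF.contrN (2 * k) (DF.pow Rd k)) / ((2 * k).factorial : ℝ)

/-- The second Gauss–Bonnet curvature `h₄ = c⁴ R² / 4!`. -/
def h4DF {n : ℕ} (Rd : DF n) : ℝ :=
  DF.toScalar (DF.contrN 4 (DF.pow Rd 2)) / (Nat.factorial 4 : ℝ)

end Geometry

end

namespace H4

/-- the 36-term polynomial as left/right antisymmetrised -/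
def row {ι : Type*} (r : ι → ι → ι → ι → ℝ) (a b c d i j k l : ι) : ℝ :=
  r a b i j * r c d k l - r a b i k * r c d j l + r a b i l * r c d j k
  + r a b j k * r c d i l - r a b j l * r c d i k + r a b k l * r c d i j

def P {ι : Type*} (r : ι → ι → ι → ι → ℝ) (i j k l : ι) : ℝ :=
  row r i j k l i j k l - row r i k j l i j k l + row r i l j k i j k l
  + row r j k i l i j k l - row r j l i k i j k l + row r k l i j i j k l

structure Anti {ι : Type*} (r : ι → ι → ι → ι → ℝ) : Prop where
  left : ∀ i j k l, r i j k l = - r j i k l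
  right : ∀ i j k l, r i j k l = - r i j l k

theorem Anti.exists_q {ι : Type*} {r : ι → ι → ι → ι → ℝ} (h : Anti r) :
    ∃ q : ι → ι → ι → ι → ℝ, r = fun i j k l => q i j k l - q j i k l - q i j l k + q j i l k := by
  refine ⟨fun i j k l => r i j k l / 4, ?_⟩
  funext i j k l
  have h1 := h.left i j k l
  have h2 := h.right i j k l
  have h3 := h.left i j l k
  simp only
  linarith

variable {ι : Type*} {r : ι → ι → ι → ι → ℝ}

theorem P_swap12 (h : Anti r) (i j k l : ι) : P r j i k l = P r i j k l := by
  obtain ⟨q, rfl⟩ := h.exists_q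
  simp only [P, row]; ring
theorem P_swap23 (h : Anti r) (i j k l : ι) : P r i k j l = P r i j k l := by
  obtain ⟨q, rfl⟩ := h.exists_q
  simp only [P, row]; ring
theorem P_swap34 (h : Anti r) (i j k l : ι) : P r i j l k = P r i j k l := by
  obtain ⟨q, rfl⟩ := h.exists_q
  simp only [P, row]; ring
theorem P_eq12 (h : Anti r) (i k l : ι) : P r i i k l = 0 := by
  obtain ⟨q, rfl⟩ := h.exists_q
  simp only [P, row]; ring

theorem P_zero (h : Anti r) (i j k l : ι)
    (hh : i = j ∨ i = k ∨ i = l ∨ j = k ∨ j = l ∨ k = l) : P r i j k l = 0 := by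
  rcases hh with rfl | rfl | rfl | rfl | rfl | rfl
  · exact P_eq12 h _ _ _
  · rw [P_swap23 h]; exact P_eq12 h _ _ _
  · rw [P_swap34 h, P_swap23 h]; exact P_eq12 h _ _ _
  · rw [← P_swap12 h, P_swap23 h]; exact P_eq12 h _ _ _
  · rw [P_swap34 h, ← P_swap12 h, P_swap23 h]; exact P_eq12 h _ _ _
  · rw [← P_swap23 h, ← P_swap34 h,  ← P_swap12 h, P_swap23 h]; exact P_eq12 h _ _ _

theorem P_sorted (h : Anti r) [LinearOrder ι] (X : ι → ι → ι → ι → ℝ)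
    (h12 : ∀ i j k l, X j i k l = X i j k l) (h23 : ∀ i j k l, X i k j l = X i j k l)
    (h34 : ∀ i j k l, X i j l k = X i j k l)
    (hX : ∀ i j k l, i < j → j < k → k < l → X i j k l = P r i j k l) :
    ∀ i j k l, i ≠ j → i ≠ k → i ≠ l → j ≠ k → j ≠ l → k ≠ l → X i j k l = P r i j k l := by
  have s1 : ∀ i j k l, i < j → j < k → k ≠ l → j ≠ l → i ≠ l → X i j k l = P r i j k l := by
    intro i j k l a b c d f
    rcases lt_or_gt_of_ne c with c | c
    · exact hX _ _ _ _ a b c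
    rw [← h34, ← P_swap34 h]
    rcases lt_or_gt_of_ne d with d | d
    · exact hX _ _ _ _ a d c
    rw [← h23, ← P_swap23 h]
    rcases lt_or_gt_of_ne f with f | f
    · exact hX _ _ _ _ f d b
    rw [← h12, ← P_swap12 h]
    exact hX _ _ _ _ f a b
  have s2 : ∀ i j k l, i < j → j ≠ k → i ≠ k → k ≠ l → j ≠ l → i ≠ l →
      X i j k l = P r i j k l := by
    intro i j k l a b b' c d f
    rcases lt_or_gt_of_ne b with b | b
    · exact s1 _ _ _ _ a b c d f
    rw [← h23, ← P_swap23 h]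
    rcases lt_or_gt_of_ne b' with b' | b'
    · exact s1 _ _ _ _ b' b d c f
    rw [← h12, ← P_swap12 h]
    exact s1 _ _ _ _ b' a d f c
  intro i j k l a b c d f g
  rcases lt_or_gt_of_ne a with a | a
  · exact s2 _ _ _ _ a d b g f c
  rw [← h12, ← P_swap12 h]
  exact s2 _ _ _ _ a b d g c f

section sums
variable [Fintype ι]

def scal (r : ι → ι → ι → ι → ℝ) : ℝ := ∑ i, ∑ j, r i j i j
def ricSq (r : ι → ι → ι → ι → ℝ) : ℝ := ∑ j, ∑ k, (∑ i, r i j i k) ^ 2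
def normSq (r : ι → ι → ι → ι → ℝ) : ℝ := ∑ i, ∑ j, ∑ k, ∑ l, r i j k l ^ 2

end sums

theorem mul_one_left {n : ℕ} (ω : DF n) : DF.mul (DF.one n) ω = ω := by
  funext S T
  unfold DF.mul DF.one
  rw [Finset.sum_eq_single ∅, Finset.sum_eq_single ∅]
  · simp [DF.shuffleSign]
  · intro b _ hb; simp [hb]
  · simp
  · intro b _ hb; simp [hb]
  · simp

theorem sign_sq {n : ℕ} (A B : Finset (Fin n)) : DF.shuffleSign A B * DF.shuffleSign A B = 1 := by
  unfold DF.shuffleSign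
  rw [← pow_add, ← two_mul, pow_mul]; simp

theorem contr_diag {n : ℕ} (ω : DF n) (S : Finset (Fin n)) :
    DF.contr ω S S = ∑ i, if i ∈ S then 0 else ω (insert i S) (insert i S) := by
  unfold DF.contr
  simp [sign_sq]

theorem contr2 {n : ℕ} (ω : DF n) : DF.toScalar (DF.contrN 2 ω) =
    ∑ i, ∑ j, if j = i then 0 else ω {j, i} {j, i} := by
  simp [DF.toScalar, DF.contrN, contr_diag]

theorem contr4 {n : ℕ} (ω : DF n) : DF.toScalar (DF.contrN 4 ω) =
    ∑ i, ∑ j, ∑ k, ∑ l, if j = i ∨ k = j ∨ k = i ∨ l = k ∨ l = j ∨ l = i then 0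
      else ω {l, k, j, i} {l, k, j, i} := by
  simp only [DF.toScalar, DF.contrN, Function.iterate_succ, Function.iterate_zero,
    Function.comp, id, contr_diag]
  refine Finset.sum_congr rfl fun i _ => ?_
  simp only [Finset.notMem_empty, if_false, insert_empty_eq]
  refine Finset.sum_congr rfl fun j _ => ?_
  by_cases h1 : j = i
  · simp [h1]
  simp only [Finset.mem_singleton, h1, if_false, false_or]
  refine Finset.sum_congr rfl fun k _ => ?_
  by_cases h2 : k = j
  · simp [h2]
  by_cases h3 : k = i
  · simp [h3]
  simp [h2, h3]

section comp
variable {n : ℕ} {V : Type*} [NormedAddCommGroup V] [InnerProductSpace ℝ V]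

theorem enum_pair {a b : Fin n} (h : a < b) (hc : ({a, b} : Finset (Fin n)).card = 2) :
    (fun i => (({a, b} : Finset (Fin n)).orderIsoOfFin hc i : Fin n)) = ![a, b] := by
  have := Finset.orderEmbOfFin_unique hc (f := ![a, b])
    (by intro x; fin_cases x <;> simp)
    (by
      intro x y hxy
      fin_cases x <;> fin_cases y <;> simp_all)
  rw [this]
  funext i
  simp

theorem ofCurv_pair (e : OrthonormalBasis (Fin n) ℝ V) (R : V → V → V → V → ℝ)
    {a b c d : Fin n} (h : a < b) (h' : c < d) :
    ofCurv e R {a, b} {c, d} = R (e a) (e b) (e c) (e d) := by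
  have h1 : ({a, b} : Finset (Fin n)).card = 2 := Finset.card_pair h.ne
  have h2 : ({c, d} : Finset (Fin n)).card = 2 := Finset.card_pair h'.ne
  unfold ofCurv ofForm
  rw [dif_pos ⟨h1, h2⟩]
  have e1 := enum_pair h h1
  have e2 := enum_pair h' h2
  have a0 := congrFun e1 0
  have a1 := congrFun e1 1
  have b0 := congrFun e2 0
  have b1 := congrFun e2 1
  simp only [Matrix.cons_val_zero, Matrix.cons_val_one] at a0 a1 b0 b1
  beta_reduce
  rw [a0, a1, b0, b1]

theorem ofCurv_card (e : OrthonormalBasis (Fin n) ℝ V) (R : V → V → V → V → ℝ)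
    (A C : Finset (Fin n)) (h : ¬ (A.card = 2 ∧ C.card = 2)) : ofCurv e R A C = 0 := by
  unfold ofCurv ofForm
  rw [dif_neg h]

end comp

def pull {n m : ℕ} (f : Fin m ↪o Fin n) (ω : DF n) : DF m :=
  fun A C => ω (A.image f) (C.image f)

theorem sign_image {n m : ℕ} (f : Fin m ↪o Fin n) (A B : Finset (Fin m)) :
    DF.shuffleSign (A.image f) (B.image f) = DF.shuffleSign A B := by
  unfold DF.shuffleSign
  rw [Finset.sum_image (fun _ _ _ _ h => f.injective h)]
  congr 1
  refine Finset.sum_congr rfl fun a _ => ?_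
  rw [Finset.filter_image, Finset.card_image_of_injective _ f.injective]
  simp

theorem mul_image {n m : ℕ} (f : Fin m ↪o Fin n) (ω θ : DF n) (S T : Finset (Fin m)) :
    DF.mul ω θ (S.image f) (T.image f) = DF.mul (pull f ω) (pull f θ) S T := by
  unfold DF.mul
  rw [Finset.powerset_image, Finset.powerset_image,
    Finset.sum_image (fun _ _ _ _ h => Finset.image_injective f.injective h)]
  refine Finset.sum_congr rfl fun A _ => ?_
  rw [Finset.sum_image (fun _ _ _ _ h => Finset.image_injective f.injective h)]
  refine Finset.sum_congr rfl fun C _ => ?_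
  rw [← Finset.image_sdiff _ _ f.injective, ← Finset.image_sdiff _ _ f.injective,
    sign_image, sign_image]
  rfl

theorem sgn_aux (A B : Finset (Fin 4)) (k : ℕ)
    (h : ∑ a ∈ A, (B.filter fun b => b < a).card = k) : DF.shuffleSign A B = (-1) ^ k := by
  unfold DF.shuffleSign; rw [h]

theorem mul_fin4 (ω : DF 4) (h : ∀ A C, ¬ (A.card = 2 ∧ C.card = 2) → ω A C = 0)
    (r : Fin 4 → Fin 4 → Fin 4 → Fin 4 → ℝ)
    (hr : ∀ a b c d, a < b → c < d → ω {a, b} {c, d} = r a b c d) :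
    DF.mul ω ω univ univ = P r 0 1 2 3 := by
  unfold DF.mul
  have hp : (powersetCard 2 (univ : Finset (Fin 4))) =
      {{0,1},{0,2},{0,3},{1,2},{1,3},{2,3}} := by decide
  have hs : ∀ F : Finset (Fin 4) → ℝ, (∀ A, A.card ≠ 2 → F A = 0) →
      ∑ A ∈ (univ : Finset (Fin 4)).powerset, F A =
        F {0,1} + F {0,2} + F {0,3} + F {1,2} + F {1,3} + F {2,3} := by
    intro F hF
    rw [← Finset.sum_subset (s₁ := powersetCard 2 univ), hp]
    · rw [Finset.sum_insert (by decide), Finset.sum_insert (by decide),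
        Finset.sum_insert (by decide), Finset.sum_insert (by decide),
        Finset.sum_insert (by decide), Finset.sum_singleton]
      ring
    · exact fun A hA => by simp
    · intro A _ hA
      exact hF A (fun hc => hA (by simp [hc]))
  rw [hs]
  swap
  · intro A hA
    refine Finset.sum_eq_zero fun C _ => ?_
    rw [h A C (fun hh => hA hh.1)]; ring
  have hs2 : ∀ A, ∑ C ∈ (univ : Finset (Fin 4)).powerset,
      DF.shuffleSign A (univ \ A) * DF.shuffleSign C (univ \ C) * ω A C * ω (univ \ A) (univ \ C)
      = _ := fun A => hs _ (fun C hC => by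
        rw [h A C (fun hh => hC hh.2)]; ring)
  simp only [hs2]
  have d1 : (univ : Finset (Fin 4)) \ {0,1} = {2,3} := by decide
  have d2 : (univ : Finset (Fin 4)) \ {0,2} = {1,3} := by decide
  have d3 : (univ : Finset (Fin 4)) \ {0,3} = {1,2} := by decide
  have d4 : (univ : Finset (Fin 4)) \ {1,2} = {0,3} := by decide
  have d5 : (univ : Finset (Fin 4)) \ {1,3} = {0,2} := by decide
  have d6 : (univ : Finset (Fin 4)) \ {2,3} = {0,1} := by decide
  have s1 := sgn_aux {0,1} {2,3} 0 (by decide)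
  have s2 := sgn_aux {0,2} {1,3} 1 (by decide)
  have s3 := sgn_aux {0,3} {1,2} 2 (by decide)
  have s4 := sgn_aux {1,2} {0,3} 2 (by decide)
  have s5 := sgn_aux {1,3} {0,2} 3 (by decide)
  have s6 := sgn_aux {2,3} {0,1} 4 (by decide)
  have l01 : (0 : Fin 4) < 1 := by decide
  have l02 : (0 : Fin 4) < 2 := by decide
  have l03 : (0 : Fin 4) < 3 := by decide
  have l12 : (1 : Fin 4) < 2 := by decide
  have l13 : (1 : Fin 4) < 3 := by decide
  have l23 : (2 : Fin 4) < 3 := by decide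
  simp only [d1, d2, d3, d4, d5, d6, s1, s2, s3, s4, s5, s6,
    hr _ _ _ _ l01 l01, hr _ _ _ _ l01 l02, hr _ _ _ _ l01 l03, hr _ _ _ _ l01 l12,
    hr _ _ _ _ l01 l13, hr _ _ _ _ l01 l23,
    hr _ _ _ _ l02 l01, hr _ _ _ _ l02 l02, hr _ _ _ _ l02 l03, hr _ _ _ _ l02 l12,
    hr _ _ _ _ l02 l13, hr _ _ _ _ l02 l23,
    hr _ _ _ _ l03 l01, hr _ _ _ _ l03 l02, hr _ _ _ _ l03 l03, hr _ _ _ _ l03 l12,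
    hr _ _ _ _ l03 l13, hr _ _ _ _ l03 l23,
    hr _ _ _ _ l12 l01, hr _ _ _ _ l12 l02, hr _ _ _ _ l12 l03, hr _ _ _ _ l12 l12,
    hr _ _ _ _ l12 l13, hr _ _ _ _ l12 l23,
    hr _ _ _ _ l13 l01, hr _ _ _ _ l13 l02, hr _ _ _ _ l13 l03, hr _ _ _ _ l13 l12,
    hr _ _ _ _ l13 l13, hr _ _ _ _ l13 l23,
    hr _ _ _ _ l23 l01, hr _ _ _ _ l23 l02, hr _ _ _ _ l23 l03, hr _ _ _ _ l23 l12,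
    hr _ _ _ _ l23 l13, hr _ _ _ _ l23 l23]
  simp only [P, row]
  ring


theorem row_sw (h : Anti r) (a b c d i j k l : ι) :
    row r a b c d j i k l = - row r a b c d i j k l ∧
    row r a b c d i k j l = - row r a b c d i j k l ∧
    row r a b c d i j l k = - row r a b c d i j k l := by
  obtain ⟨q, rfl⟩ := h.exists_q
  refine ⟨?_, ?_, ?_⟩ <;> simp only [row] <;> ring


section sums2
variable {ι : Type*} [Fintype ι] {r : ι → ι → ι → ι → ℝ}

theorem sw12 (F : ι → ι → ι → ι → ℝ) :
    ∑ i, ∑ j, ∑ k, ∑ l, F j i k l = ∑ i, ∑ j, ∑ k, ∑ l, F i j k l := Finset.sum_comm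
theorem sw23 (F : ι → ι → ι → ι → ℝ) :
    ∑ i, ∑ j, ∑ k, ∑ l, F i k j l = ∑ i, ∑ j, ∑ k, ∑ l, F i j k l :=
  Finset.sum_congr rfl fun _ _ => Finset.sum_comm
theorem sw34 (F : ι → ι → ι → ι → ℝ) :
    ∑ i, ∑ j, ∑ k, ∑ l, F i j l k = ∑ i, ∑ j, ∑ k, ∑ l, F i j k l :=
  Finset.sum_congr rfl fun _ _ => Finset.sum_congr rfl fun _ _ => Finset.sum_comm

theorem sum_P (h : Anti r) : ∑ i, ∑ j, ∑ k, ∑ l, P r i j k l =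
    6 * ∑ i, ∑ j, ∑ k, ∑ l, row r i j k l i j k l := by
  have r1 := fun a b c d i j k l => (row_sw h a b c d i j k l).1
  have r2 := fun a b c d i j k l => (row_sw h a b c d i j k l).2.1
  have r3 := fun a b c d i j k l => (row_sw h a b c d i j k l).2.2
  set T := ∑ i, ∑ j, ∑ k, ∑ l, row r i j k l i j k l with hT
  have t2 : ∑ i, ∑ j, ∑ k, ∑ l, row r i k j l i j k l = - T := by
    rw [← sw23]
    simp only [hT, ← Finset.sum_neg_distrib]
    refine Finset.sum_congr rfl fun i _ => Finset.sum_congr rfl fun j _ =>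
      Finset.sum_congr rfl fun k _ => Finset.sum_congr rfl fun l _ => ?_
    exact r2 _ _ _ _ i j k l
  have t3 : ∑ i, ∑ j, ∑ k, ∑ l, row r i l j k i j k l = T := by
    rw [← sw34, ← sw23]
    simp only [hT]
    refine Finset.sum_congr rfl fun i _ => Finset.sum_congr rfl fun j _ =>
      Finset.sum_congr rfl fun k _ => Finset.sum_congr rfl fun l _ => ?_
    rw [r3 _ _ _ _ i k j l, r2 _ _ _ _ i j k l, neg_neg]
  have t4 : ∑ i, ∑ j, ∑ k, ∑ l, row r j k i l i j k l = T := by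
    rw [← sw12, ← sw23]
    simp only [hT]
    refine Finset.sum_congr rfl fun i _ => Finset.sum_congr rfl fun j _ =>
      Finset.sum_congr rfl fun k _ => Finset.sum_congr rfl fun l _ => ?_
    rw [r1 _ _ _ _ i k j l, r2 _ _ _ _ i j k l, neg_neg]
  have t5 : ∑ i, ∑ j, ∑ k, ∑ l, row r j l i k i j k l = - T := by
    rw [← sw12, ← sw34, ← sw23]
    simp only [hT, ← Finset.sum_neg_distrib]
    refine Finset.sum_congr rfl fun i _ => Finset.sum_congr rfl fun j _ =>
      Finset.sum_congr rfl fun k _ => Finset.sum_congr rfl fun l _ => ?_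
    rw [r1 _ _ _ _ i k l j, r3 _ _ _ _ i k j l, r2 _ _ _ _ i j k l, neg_neg]
  have t6 : ∑ i, ∑ j, ∑ k, ∑ l, row r k l i j i j k l = T := by
    rw [← sw23, ← sw12, ← sw34, ← sw23]
    have : ∀ a b c d i j k l, row r a b c d k l i j = row r a b c d i j k l := by
      intro a b c d i j k l
      simp only [row]; ring_nf
      obtain ⟨q, rfl⟩ := h.exists_q
      ring
    simp only [hT]
    refine Finset.sum_congr rfl fun i _ => Finset.sum_congr rfl fun j _ =>
      Finset.sum_congr rfl fun k _ => Finset.sum_congr rfl fun l _ => ?_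
    exact this _ _ _ _ i j k l
  simp only [P, Finset.sum_add_distrib, Finset.sum_sub_distrib, t2, t3, t4, t5, t6]
  ring

theorem ricSq_eq : ∑ i, ∑ j, ∑ k, ∑ l, r i j i k * r l j l k = ricSq r := by
  unfold ricSq
  rw [Finset.sum_comm]
  refine Finset.sum_congr rfl fun j _ => ?_
  rw [Finset.sum_comm]
  refine Finset.sum_congr rfl fun k _ => ?_
  rw [sq, Finset.sum_mul_sum]

theorem sum_row (h : Anti r) (hp : ∀ i j k l, r i j k l = r k l i j) :
    ∑ i, ∑ j, ∑ k, ∑ l, row r i j k l i j k l = scal r ^ 2 - 4 * ricSq r + normSq r := by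
  have u1 : ∑ i, ∑ j, ∑ k, ∑ l, r i j i j * r k l k l = scal r ^ 2 := by
    unfold scal
    rw [sq]
    simp only [Finset.sum_mul]
    simp only [Finset.mul_sum]
  have u2 : ∑ i, ∑ j, ∑ k, ∑ l, r i j i k * r k l j l = ricSq r := by
    rw [← ricSq_eq]
    refine Finset.sum_congr rfl fun i _ => Finset.sum_congr rfl fun j _ =>
      Finset.sum_congr rfl fun k _ => Finset.sum_congr rfl fun l _ => ?_
    rw [h.left k l j l, h.right l k j l, hp l k l j]; ring
  have u3 : ∑ i, ∑ j, ∑ k, ∑ l, r i j i l * r k l j k = - ricSq r := by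
    rw [← ricSq_eq, ← sw34]
    simp only [← Finset.sum_neg_distrib]
    refine Finset.sum_congr rfl fun i _ => Finset.sum_congr rfl fun j _ =>
      Finset.sum_congr rfl fun k _ => Finset.sum_congr rfl fun l _ => ?_
    rw [hp l k j l, h.left j l l k]; ring
  have u4 : ∑ i, ∑ j, ∑ k, ∑ l, r i j j k * r k l i l = - ricSq r := by
    rw [← ricSq_eq, ← sw12]
    simp only [← Finset.sum_neg_distrib]
    refine Finset.sum_congr rfl fun i _ => Finset.sum_congr rfl fun j _ =>
      Finset.sum_congr rfl fun k _ => Finset.sum_congr rfl fun l _ => ?_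
    rw [h.left j i i k, h.left k l j l, h.right l k j l, hp l k l j]; ring
  have u5 : ∑ i, ∑ j, ∑ k, ∑ l, r i j j l * r k l i k = ricSq r := by
    rw [← ricSq_eq, ← sw12, ← sw34]
    refine Finset.sum_congr rfl fun i _ => Finset.sum_congr rfl fun j _ =>
      Finset.sum_congr rfl fun k _ => Finset.sum_congr rfl fun l _ => ?_
    rw [h.left j i i k, hp l k j l, h.left j l l k]; ring
  have u6 : ∑ i, ∑ j, ∑ k, ∑ l, r i j k l * r k l i j = normSq r := by
    unfold normSq
    refine Finset.sum_congr rfl fun i _ => Finset.sum_congr rfl fun j _ =>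
      Finset.sum_congr rfl fun k _ => Finset.sum_congr rfl fun l _ => ?_
    rw [hp k l i j]; ring
  simp only [row, Finset.sum_add_distrib, Finset.sum_sub_distrib, u1, u2, u3, u4, u5, u6]
  ring

end sums2

section main1
variable {n : ℕ} {V : Type*} [NormedAddCommGroup V] [InnerProductSpace ℝ V]

/-- components of a curvature tensor in a family of vectors -/
def cmp {ι : Type*} (e : ι → V) (R : V → V → V → V → ℝ) : ι → ι → ι → ι → ℝ :=
  fun i j k l => R (e i) (e j) (e k) (e l)

theorem right_anti {R : V → V → V → V → ℝ} (hR : IsCurv R) (x y z w : V) :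
    R x y z w = - R x y w z := by
  rw [hR.pair_symm, hR.antisymm, hR.pair_symm]

theorem cmp_anti {ι : Type*} (e : ι → V) {R : V → V → V → V → ℝ} (hR : IsCurv R) :
    Anti (cmp e R) :=
  ⟨fun _ _ _ _ => hR.antisymm _ _ _ _, fun _ _ _ _ => right_anti hR _ _ _ _⟩

theorem mul_sorted (e : OrthonormalBasis (Fin n) ℝ V) (R : V → V → V → V → ℝ)
    (i j k l : Fin n) (h1 : i < j) (h2 : j < k) (h3 : k < l) :
    DF.mul (ofCurv e R) (ofCurv e R) {l, k, j, i} {l, k, j, i} = P (cmp e R) i j k l := by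
  have hm : StrictMono ![i, j, k, l] := by
    rw [Fin.strictMono_iff_lt_succ]
    intro x
    fin_cases x
    · exact h1
    · exact h2
    · exact h3
  let f : Fin 4 ↪o Fin n := OrderEmbedding.ofStrictMono _ hm
  have hf : ({l, k, j, i} : Finset (Fin n)) = (univ : Finset (Fin 4)).image f := by
    ext x
    simp only [Finset.mem_insert, Finset.mem_singleton, Finset.mem_image, Finset.mem_univ,
      true_and, Fin.exists_fin_succ, Fin.exists_fin_zero]
    simp [f, eq_comm]
    tauto
  rw [hf, mul_image, mul_fin4 _ _ (fun a b c d => cmp e R (f a) (f b) (f c) (f d))]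
  · rfl
  · intro a b c d hab hcd
    unfold pull
    simp only [Finset.image_insert, Finset.image_singleton]
    exact ofCurv_pair e R (f.strictMono hab) (f.strictMono hcd)
  · intro A C hAC
    refine ofCurv_card e R _ _ ?_
    rwa [Finset.card_image_of_injective _ f.injective,
      Finset.card_image_of_injective _ f.injective]

theorem h4_formula (e : OrthonormalBasis (Fin n) ℝ V) {R : V → V → V → V → ℝ} (hR : IsCurv R) :
    h4DF (ofCurv e R) =
      (scal (cmp e R) ^ 2 - 4 * ricSq (cmp e R) + normSq (cmp e R)) / 4 := by
  have hA := cmp_anti e hR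
  have key : DF.toScalar (DF.contrN 4 (DF.pow (ofCurv e R) 2)) =
      ∑ i, ∑ j, ∑ k, ∑ l, P (cmp e R) i j k l := by
    have hpow : DF.pow (ofCurv e R) 2 = DF.mul (ofCurv e R) (ofCurv e R) := by
      simp only [DF.pow, mul_one_left]
    rw [hpow, contr4]
    refine Finset.sum_congr rfl fun i _ => Finset.sum_congr rfl fun j _ =>
      Finset.sum_congr rfl fun k _ => Finset.sum_congr rfl fun l _ => ?_
    split_ifs with hc
    · rw [P_zero hA]
      simp only [eq_comm] at hc ⊢
      tauto
    · push Not at hc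
      obtain ⟨c1, c2, c3, c4, c5, c6⟩ := hc
      refine P_sorted hA
        (fun i j k l => DF.mul (ofCurv e R) (ofCurv e R) {l, k, j, i} {l, k, j, i})
        ?_ ?_ ?_ (mul_sorted e R) i j k l c1.symm c3.symm c6.symm c2.symm c5.symm c4.symm
      · intro i j k l
        have : ({l, k, i, j} : Finset (Fin n)) = {l, k, j, i} := by
          ext x; simp only [Finset.mem_insert, Finset.mem_singleton]; tauto
        simp only [this]
      · intro i j k l
        have : ({l, j, k, i} : Finset (Fin n)) = {l, k, j, i} := by
          ext x; simp only [Finset.mem_insert, Finset.mem_singleton]; tauto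
        simp only [this]
      · intro i j k l
        have : ({k, l, j, i} : Finset (Fin n)) = {l, k, j, i} := by
          ext x; simp only [Finset.mem_insert, Finset.mem_singleton]; tauto
        simp only [this]
  unfold h4DF
  rw [key, sum_P hA, sum_row hA (fun _ _ _ _ => hR.pair_symm _ _ _ _)]
  norm_num [Nat.factorial]
  ring

theorem scal_formula (e : OrthonormalBasis (Fin n) ℝ V) {R : V → V → V → V → ℝ}
    (hR : IsCurv R) : scalDF (ofCurv e R) = scal (cmp e R) := by
  have hA := cmp_anti e hR
  unfold scalDF scal
  rw [contr2]
  refine Finset.sum_congr rfl fun i _ => Finset.sum_congr rfl fun j _ => ?_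
  split_ifs with h
  · subst h
    have := hA.left j j j j
    linarith
  · rcases lt_or_gt_of_ne h with h | h
    · rw [ofCurv_pair e R h h, hR.antisymm, right_anti hR, neg_neg]; rfl
    · rw [Finset.pair_comm, ofCurv_pair e R h h]; rfl

theorem low_dim (hn : n ≤ 3) {r : Fin n → Fin n → Fin n → Fin n → ℝ} (h : Anti r)
    (hp : ∀ i j k l, r i j k l = r k l i j) :
    scal r ^ 2 - 4 * ricSq r + normSq r = 0 := by
  have h1 := sum_P h
  rw [sum_row h hp] at h1
  have h2 : ∑ i, ∑ j, ∑ k, ∑ l, P r i j k l = 0 := by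
    refine Finset.sum_eq_zero fun i _ => Finset.sum_eq_zero fun j _ =>
      Finset.sum_eq_zero fun k _ => Finset.sum_eq_zero fun l _ => P_zero h _ _ _ _ ?_
    simp only [Fin.ext_iff]
    omega
  linarith

end main1

section inv
variable {ι κ : Type*} [Fintype ι] [Fintype κ] {V : Type*} [NormedAddCommGroup V]
  [InnerProductSpace ℝ V]

/-- linearity of a real function -/
def Lin (φ : V → ℝ) : Prop := ∀ (c : ℝ) (x x' : V), φ (c • x + x') = c * φ x + φ x'

theorem Lin.zero {φ : V → ℝ} (h : Lin φ) : φ 0 = 0 := by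
  have := h 1 0 0
  simp at this
  exact this

theorem Lin.sum {φ : V → ℝ} (h : Lin φ) {α : Type*} (s : Finset α) (a : α → ℝ) (v : α → V) :
    φ (∑ i ∈ s, a i • v i) = ∑ i ∈ s, a i * φ (v i) := by
  classical
  induction s using Finset.induction_on with
  | empty => simp [h.zero]
  | insert x s hx ih => rw [Finset.sum_insert hx, Finset.sum_insert hx, h, ih]

theorem trace_inv (e : OrthonormalBasis ι ℝ V) (f : OrthonormalBasis κ ℝ V) {b : V → V → ℝ}
    (h1 : ∀ y, Lin fun x => b x y) (h2 : ∀ x, Lin fun y => b x y) :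
    ∑ i, b (e i) (e i) = ∑ j, b (f j) (f j) := by
  classical
  have hb : ∀ i, b (e i) (e i) =
      ∑ j, ∑ k, (inner ℝ (f j) (e i) * inner ℝ (e i) (f k)) * b (f j) (f k) := by
    intro i
    have hx : e i = ∑ j, (inner ℝ (f j) (e i)) • f j := (f.sum_repr' (e i)).symm
    calc b (e i) (e i) = b (∑ j, (inner ℝ (f j) (e i)) • f j) (e i) := by rw [← hx]
      _ = ∑ j, inner ℝ (f j) (e i) * b (f j) (e i) := (h1 (e i)).sum _ _ _
      _ = _ := by
        refine Finset.sum_congr rfl fun j _ => ?_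
        have : b (f j) (e i) = ∑ k, inner ℝ (f k) (e i) * b (f j) (f k) := by
          conv_lhs => rw [hx]
          exact (h2 (f j)).sum _ _ _
        rw [this, Finset.mul_sum]
        refine Finset.sum_congr rfl fun k _ => ?_
        rw [real_inner_comm (e i) (f k)]; ring
  simp only [hb]
  rw [Finset.sum_comm]
  refine Finset.sum_congr rfl fun j _ => ?_
  rw [Finset.sum_comm]
  simp only [← Finset.sum_mul, e.sum_inner_mul_inner]
  rw [Finset.sum_eq_single j]
  · simp
  · intro k _ hk
    rw [f.orthonormal.2 (Ne.symm hk)]; simp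
  · simp

theorem sq_inv (e : OrthonormalBasis ι ℝ V) (f : OrthonormalBasis κ ℝ V) {φ : V → ℝ}
    (h : Lin φ) : ∑ i, φ (e i) ^ 2 = ∑ j, φ (f j) ^ 2 := by
  simp only [sq]
  refine trace_inv e f (b := fun x y => φ x * φ y) ?_ ?_
  · intro y c x x'; simp only [h c x x']; ring
  · intro y c x x'; simp only [h c x x']; ring

theorem sq2_inv (e : OrthonormalBasis ι ℝ V) (f : OrthonormalBasis κ ℝ V) {b : V → V → ℝ}
    (h1 : ∀ y, Lin fun x => b x y) (h2 : ∀ x, Lin fun y => b x y) :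
    ∑ i, ∑ j, b (e i) (e j) ^ 2 = ∑ i, ∑ j, b (f i) (f j) ^ 2 := by
  have : ∀ x, ∑ j, b x (e j) ^ 2 = ∑ j, b x (f j) ^ 2 := fun x => sq_inv e f (h2 x)
  simp only [this]
  rw [Finset.sum_comm]
  symm
  rw [Finset.sum_comm]
  symm
  exact Finset.sum_congr rfl fun j _ => sq_inv e f (h1 (f j))

theorem comm4 (F : ι → ι → κ → κ → ℝ) :
    ∑ i, ∑ j, ∑ k, ∑ l, F i j k l = ∑ k, ∑ l, ∑ i, ∑ j, F i j k l := by
  have h1 : ∀ i, ∑ j, ∑ k, ∑ l, F i j k l = ∑ k, ∑ l, ∑ j, F i j k l := by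
    intro i
    rw [Finset.sum_comm]
    exact Finset.sum_congr rfl fun k _ => Finset.sum_comm
  simp only [h1]
  rw [Finset.sum_comm]
  exact Finset.sum_congr rfl fun k _ => Finset.sum_comm


theorem lin1 {R : V → V → V → V → ℝ} (hR : IsCurv R)
    (y z w : V) : Lin fun x => R x y z w := fun c x x' => hR.linear c x x' y z w
theorem lin2 {R : V → V → V → V → ℝ} (hR : IsCurv R)
    (x z w : V) : Lin fun y => R x y z w := fun c y y' => by
  simp only
  rw [hR.antisymm x, hR.linear, hR.antisymm x y, hR.antisymm x y']; ring
theorem lin3 {R : V → V → V → V → ℝ} (hR : IsCurv R)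
    (x y w : V) : Lin fun z => R x y z w := fun c z z' => by
  simp only
  rw [hR.pair_symm x, hR.linear, hR.pair_symm x y z, hR.pair_symm x y z']
theorem lin4 {R : V → V → V → V → ℝ} (hR : IsCurv R)
    (x y z : V) : Lin fun w => R x y z w := fun c w w' => by
  have := lin2 hR z x y c w w'
  simp only at this ⊢
  rw [hR.pair_symm x, this, hR.pair_symm x y z, hR.pair_symm x y z]

theorem tr_inv {R : V → V → V → V → ℝ} (hR : IsCurv R)
    (e : OrthonormalBasis ι ℝ V) (f : OrthonormalBasis κ ℝ V) (y z : V) :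
    ∑ i, R (e i) y (e i) z = ∑ i, R (f i) y (f i) z :=
  trace_inv e f (b := fun x x' => R x y x' z) (fun _ => lin1 hR _ _ _) (fun _ => lin3 hR _ _ _)

theorem scal_inv {R : V → V → V → V → ℝ} (hR : IsCurv R)
    (e : OrthonormalBasis ι ℝ V) (f : OrthonormalBasis κ ℝ V) :
    scal (cmp e R) = scal (cmp f R) := by
  unfold scal cmp
  rw [Finset.sum_comm, Finset.sum_comm (s := (univ : Finset κ))]
  simp only [tr_inv hR e f]
  refine trace_inv e f (b := fun y z => ∑ i, R (f i) y (f i) z) ?_ ?_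
  · intro z c y y'
    simp only [lin2 hR _ _ _ c y y', Finset.sum_add_distrib, Finset.mul_sum]
  · intro z c y y'
    simp only [lin4 hR _ _ _ c y y', Finset.sum_add_distrib, Finset.mul_sum]

theorem ric_inv {R : V → V → V → V → ℝ} (hR : IsCurv R)
    (e : OrthonormalBasis ι ℝ V) (f : OrthonormalBasis κ ℝ V) :
    ricSq (cmp e R) = ricSq (cmp f R) := by
  unfold ricSq cmp
  simp only [tr_inv hR e f]
  refine sq2_inv e f (b := fun y z => ∑ i, R (f i) y (f i) z) ?_ ?_
  · intro z c y y'
    simp only [lin2 hR _ _ _ c y y', Finset.sum_add_distrib, Finset.mul_sum]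
  · intro z c y y'
    simp only [lin4 hR _ _ _ c y y', Finset.sum_add_distrib, Finset.mul_sum]

theorem norm_inv {R : V → V → V → V → ℝ} (hR : IsCurv R)
    (e : OrthonormalBasis ι ℝ V) (f : OrthonormalBasis κ ℝ V) :
    normSq (cmp e R) = normSq (cmp f R) := by
  unfold normSq cmp
  have h1 : ∀ x y, ∑ k, ∑ l, R x y (e k) (e l) ^ 2 = ∑ k, ∑ l, R x y (f k) (f l) ^ 2 :=
    fun x y => sq2_inv e f (b := R x y) (fun _ => lin3 hR _ _ _) (fun _ => lin4 hR _ _ _)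
  have h2 : ∀ z w, ∑ k, ∑ l, R (e k) (e l) z w ^ 2 = ∑ k, ∑ l, R (f k) (f l) z w ^ 2 :=
    fun z w => sq2_inv e f (b := fun x y => R x y z w) (fun _ => lin1 hR _ _ _)
      (fun _ => lin2 hR _ _ _)
  simp only [h1]
  rw [comm4]
  simp only [h2]
  rw [comm4]

end inv

section product
variable {ι κ : Type*} [Fintype ι] [Fintype κ]

/-- direct sum of components -/
structure IsSum (r : ι ⊕ κ → ι ⊕ κ → ι ⊕ κ → ι ⊕ κ → ℝ) (a : ι → ι → ι → ι → ℝ)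
    (b : κ → κ → κ → κ → ℝ) : Prop where
  eq : ∀ i j k l, r i j k l =
    (match i, j, k, l with
      | .inl i, .inl j, .inl k, .inl l => a i j k l
      | .inr i, .inr j, .inr k, .inr l => b i j k l
      | _, _, _, _ => 0)

theorem IsSum.scal {r : ι ⊕ κ → ι ⊕ κ → ι ⊕ κ → ι ⊕ κ → ℝ} {a : ι → ι → ι → ι → ℝ}
    {b : κ → κ → κ → κ → ℝ} (h : IsSum r a b) : scal r = H4.scal a + H4.scal b := by
  simp [H4.scal, Fintype.sum_sum_type, h.eq]

theorem IsSum.ric {r : ι ⊕ κ → ι ⊕ κ → ι ⊕ κ → ι ⊕ κ → ℝ} {a : ι → ι → ι → ι → ℝ}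
    {b : κ → κ → κ → κ → ℝ} (h : IsSum r a b) : ricSq r = ricSq a + ricSq b := by
  simp [H4.ricSq, Fintype.sum_sum_type, h.eq]

theorem IsSum.norm {r : ι ⊕ κ → ι ⊕ κ → ι ⊕ κ → ι ⊕ κ → ℝ} {a : ι → ι → ι → ι → ℝ}
    {b : κ → κ → κ → κ → ℝ} (h : IsSum r a b) : normSq r = normSq a + normSq b := by
  simp [H4.normSq, Fintype.sum_sum_type, h.eq]

end product

end H4

/-- If `R₁, R₂` are algebraic curvature tensors on inner product
spaces of dimensions `n₁ ≤ 3` and `n₂ ≤ 3`, and `R = R₁ ⊕ R₂` is the product curvature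
tensor on the orthogonal direct sum, then `h₄(R) = (1/2)·Scal(R₁)·Scal(R₂)`. -/
theorem stmt14_h4_of_low_dimensional_product
    (n₁ n₂ : ℕ) (hn₁ : n₁ ≤ 3) (hn₂ : n₂ ≤ 3)
    (V₁ : Type*) [NormedAddCommGroup V₁] [InnerProductSpace ℝ V₁]
    (V₂ : Type*) [NormedAddCommGroup V₂] [InnerProductSpace ℝ V₂]
    (hV₁ : Module.finrank ℝ V₁ = n₁) (hV₂ : Module.finrank ℝ V₂ = n₂)
    (e₁ : OrthonormalBasis (Fin n₁) ℝ V₁) (e₂ : OrthonormalBasis (Fin n₂) ℝ V₂)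
    (e : OrthonormalBasis (Fin (n₁ + n₂)) ℝ (WithLp 2 (V₁ × V₂)))
    (R₁ : V₁ → V₁ → V₁ → V₁ → ℝ) (hR₁ : IsCurv R₁)
    (R₂ : V₂ → V₂ → V₂ → V₂ → ℝ) (hR₂ : IsCurv R₂)
    (R : WithLp 2 (V₁ × V₂) → WithLp 2 (V₁ × V₂) → WithLp 2 (V₁ × V₂) →
      WithLp 2 (V₁ × V₂) → ℝ)
    (hR : ∀ x y z w, R x y z w =
      R₁ (WithLp.equiv 2 (V₁ × V₂) x).1 (WithLp.equiv 2 (V₁ × V₂) y).1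
         (WithLp.equiv 2 (V₁ × V₂) z).1 (WithLp.equiv 2 (V₁ × V₂) w).1
      + R₂ (WithLp.equiv 2 (V₁ × V₂) x).2 (WithLp.equiv 2 (V₁ × V₂) y).2
           (WithLp.equiv 2 (V₁ × V₂) z).2 (WithLp.equiv 2 (V₁ × V₂) w).2) :
    h4DF (ofCurv e R) = (1 / 2) * scalDF (ofCurv e₁ R₁) * scalDF (ofCurv e₂ R₂) := by
  have hC : IsCurv R := by
    refine ⟨?_, ?_, ?_, ?_⟩
    · intro c x x' y z w
      simp only [hR]
      have h1 := hR₁.linear c (WithLp.equiv 2 (V₁ × V₂) x).1 (WithLp.equiv 2 (V₁ × V₂) x').1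
      have h2 := hR₂.linear c (WithLp.equiv 2 (V₁ × V₂) x).2 (WithLp.equiv 2 (V₁ × V₂) x').2
      have e1 : (WithLp.equiv 2 (V₁ × V₂) (c • x + x')).1 =
        c • (WithLp.equiv 2 (V₁ × V₂) x).1 + (WithLp.equiv 2 (V₁ × V₂) x').1 := rfl
      have e2 : (WithLp.equiv 2 (V₁ × V₂) (c • x + x')).2 =
        c • (WithLp.equiv 2 (V₁ × V₂) x).2 + (WithLp.equiv 2 (V₁ × V₂) x').2 := rfl
      rw [e1, e2, h1, h2]; ring
    · intro x y z w
      simp only [hR]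
      rw [hR₁.antisymm, hR₂.antisymm]; ring
    · intro x y z w
      simp only [hR]
      rw [hR₁.pair_symm, hR₂.pair_symm]
    · intro x y z w
      simp only [hR]
      linarith [hR₁.bianchi (WithLp.equiv 2 (V₁ × V₂) x).1 (WithLp.equiv 2 (V₁ × V₂) y).1
         (WithLp.equiv 2 (V₁ × V₂) z).1 (WithLp.equiv 2 (V₁ × V₂) w).1,
        hR₂.bianchi (WithLp.equiv 2 (V₁ × V₂) x).2 (WithLp.equiv 2 (V₁ × V₂) y).2
         (WithLp.equiv 2 (V₁ × V₂) z).2 (WithLp.equiv 2 (V₁ × V₂) w).2]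
  have hS : H4.IsSum (H4.cmp (e₁.prod e₂) R) (H4.cmp e₁ R₁) (H4.cmp e₂ R₂) := by
    have z1 := fun y z w => (H4.lin1 hR₁ y z w).zero
    have z2 := fun y z w => (H4.lin2 hR₁ y z w).zero
    have z3 := fun y z w => (H4.lin3 hR₁ y z w).zero
    have z4 := fun y z w => (H4.lin4 hR₁ y z w).zero
    have y1 := fun y z w => (H4.lin1 hR₂ y z w).zero
    have y2 := fun y z w => (H4.lin2 hR₂ y z w).zero
    have y3 := fun y z w => (H4.lin3 hR₂ y z w).zero
    have y4 := fun y z w => (H4.lin4 hR₂ y z w).zero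
    constructor
    intro i j k l
    rcases i with i | i <;> rcases j with j | j <;> rcases k with k | k <;> rcases l with l | l <;>
      simp [H4.cmp, hR, OrthonormalBasis.prod_apply, z1, z2, z3, z4, y1, y2, y3, y4]
  rw [H4.h4_formula e hC, H4.scal_formula e₁ hR₁, H4.scal_formula e₂ hR₂,
    H4.scal_inv hC e (e₁.prod e₂), H4.ric_inv hC e (e₁.prod e₂), H4.norm_inv hC e (e₁.prod e₂),
    hS.scal, hS.ric, hS.norm]
  have l1 := H4.low_dim hn₁ (H4.cmp_anti e₁ hR₁) (fun _ _ _ _ => hR₁.pair_symm _ _ _ _)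
  have l2 := H4.low_dim hn₂ (H4.cmp_anti e₂ hR₂) (fun _ _ _ _ => hR₂.pair_symm _ _ _ _)
  linear_combination (1 / 4) * l1 + (1 / 4) * l2
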